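/- Let p ≥ 1 be an integer, τ > 0, and a, b ∈ ℂ^p with Σ_{j=1}^p a_j = Σ_{j=1}^p b_j. Fix ε ∈ (0, π/2) and c ∈ ℝ with c < min_{1≤j≤p} Re(a_j). Then for every z ∈ (0,1) the two integrals I_±(z) := ∫₀^∞ 𝒢^{p,0}_{p,p}(a;b | c + t·e^{±i(π−ε)}; τ) · exp(−(c + t·e^{±i(π−ε)})·log(z)) dt converge absolutely and (1/(2πi))·( e^{i(π−ε)}·I_+(z) − e^{−i(π−ε)}·I_−(z) ) = 0; that is, the Mellin–Barnes integral of 𝒢^{p,0}_{p,p}(a;b|s;τ)·z^{−s} over the contour consisting of the ray from ∞·e^{−i(π−ε)}+c to c followed by the ray from c to ∞·e^{i(π−ε)}+c vanishes (this quantity is the K-function K^{p,0}_{p,p}(a;b|z;τ) of the logarithmic case). Here 𝒢^{p,0}_{p,p}(a;b|s;τ) = ∏_{j=1}^p G(b_j−s;τ) / ∏_{j=1}^p G(a_j−s;τ). -/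

import Mathlib

open Complex Filter MeasureTheory Set

noncomputable section

/-- The digamma function ψ = Γ'/Γ. -/
def digammaC (z : ℂ) : ℂ := deriv Complex.Gamma z / Complex.Gamma z

/-- The gamma modular form C(τ). -/
def gammaModC (τ : ℂ) : ℂ :=
  limUnder atTop fun M : ℕ =>
    (∑ k ∈ Finset.Ico 1 M, digammaC (k * τ)) + digammaC (M * τ) / 2
      - (1 / τ) * Complex.log (Complex.Gamma (M * τ) / (Real.sqrt (2 * Real.pi) : ℂ))

/-- The gamma modular form D(τ). -/
def gammaModD (τ : ℂ) : ℂ :=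
  limUnder atTop fun M : ℕ =>
    (∑ k ∈ Finset.Ico 1 M, deriv digammaC (k * τ)) + deriv digammaC (M * τ) / 2
      - (1 / τ) * digammaC (M * τ)

def aBarnes (τ : ℂ) : ℂ :=
  -(Real.eulerMascheroniConstant : ℂ) * τ + (τ / 2) * Complex.log (2 * Real.pi * τ)
    + (1 / 2) * Complex.log τ - τ * gammaModC τ

def bBarnes (τ : ℂ) : ℂ :=
  -(Real.pi : ℂ) ^ 2 * τ ^ 2 / 6 - τ * Complex.log τ - τ ^ 2 * gammaModD τ

/-- The Barnes double gamma function `G(z;τ)`, via its Weierstrass product. -/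
def barnesG (z τ : ℂ) : ℂ :=
  z / τ * Complex.exp (aBarnes τ * z / τ + bBarnes τ * z ^ 2 / (2 * τ)) *
    ∏' mn : ℕ × ℕ,
      if mn = (0, 0) then 1
      else (1 + z / (mn.1 * τ + mn.2)) *
        Complex.exp (-(z / (mn.1 * τ + mn.2)) + z ^ 2 / (2 * ((mn.1 : ℂ) * τ + (mn.2 : ℂ)) ^ 2))

/-- The ratio of Barnes double gamma functions `𝒢^{m,n}_{p,q}(a;b | s;τ)`. -/
def calG (m n : ℕ) {p q : ℕ} (a : Fin p → ℂ) (b : Fin q → ℂ) (s τ : ℂ) : ℂ :=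
  ((∏ j : Fin q, if (j : ℕ) < m then barnesG (b j - s) τ else 1) *
      ∏ j : Fin p, if (j : ℕ) < n then barnesG (1 + τ - a j + s) τ else 1) /
    ((∏ j : Fin q, if m ≤ (j : ℕ) then barnesG (1 + τ - b j + s) τ else 1) *
      ∏ j : Fin p, if n ≤ (j : ℕ) then barnesG (a j - s) τ else 1)

/-- The Weierstrass elementary factor of genus two. -/
def elemFactor (x : ℂ) : ℂ := (1 + x) * Complex.exp (-x + x ^ 2 / 2)

lemma elemFactor_zero : elemFactor 0 = 1 := by simp [elemFactor]

lemma differentiable_elemFactor : Differentiable ℂ elemFactor := by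
  unfold elemFactor; fun_prop

lemma exists_exp_eq_elemFactor {x : ℂ} (hx : ‖x‖ ≤ 1 / 2) :
    ∃ w : ℂ, ‖w‖ ≤ ‖x‖ ^ 3 ∧ elemFactor x = Complex.exp w := by
  have hlt : ‖x‖ < 1 := by linarith
  have hne : 1 + x ≠ 0 := by
    intro h
    have : x = -1 := by linear_combination h
    rw [this] at hlt
    simp at hlt
  refine ⟨Complex.log (1 + x) - x + x ^ 2 / 2, ?_, ?_⟩
  · have h := Complex.norm_log_sub_logTaylor_le 2 hlt
    have ht : Complex.logTaylor (2 + 1) x = x - x ^ 2 / 2 := by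
      simp [Complex.logTaylor, Finset.sum_range_succ]
      ring
    rw [ht] at h
    have e : Complex.log (1 + x) - x + x ^ 2 / 2 = Complex.log (1 + x) - (x - x ^ 2 / 2) := by ring
    rw [e]
    refine h.trans ?_
    have h2 : (1 - ‖x‖)⁻¹ ≤ 2 := by
      rw [inv_le_comm₀ (by linarith) (by norm_num)]; linarith
    have h3 : 0 ≤ ‖x‖ ^ 3 := by positivity
    norm_num
    nlinarith
  · rw [elemFactor, show Complex.log (1 + x) - x + x ^ 2 / 2
      = Complex.log (1 + x) + (-x + x ^ 2 / 2) by ring,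
      Complex.exp_add (Complex.log (1 + x)), Complex.exp_log hne]

lemma norm_elemFactor_le (x : ℂ) : ‖elemFactor x‖ ≤ Real.exp (9 * ‖x‖ ^ 3) := by
  have h3 : 0 ≤ ‖x‖ ^ 3 := by positivity
  rcases le_total ‖x‖ (1 / 2) with hx | hx
  · obtain ⟨w, hw, he⟩ := exists_exp_eq_elemFactor hx
    rw [he]
    refine (Complex.norm_exp_le_exp_norm w).trans (Real.exp_le_exp.2 ?_)
    linarith
  · rw [elemFactor, norm_mul]
    have h1 : ‖1 + x‖ ≤ Real.exp ‖x‖ := by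
      refine (norm_add_le _ _).trans ?_
      rw [norm_one, add_comm]
      exact Real.add_one_le_exp _
    have h2 : ‖Complex.exp (-x + x ^ 2 / 2)‖ ≤ Real.exp (‖x‖ + ‖x‖ ^ 2 / 2) := by
      refine (Complex.norm_exp_le_exp_norm _).trans (Real.exp_le_exp.2 ?_)
      refine (norm_add_le _ _).trans ?_
      simp
    calc _ ≤ Real.exp ‖x‖ * Real.exp (‖x‖ + ‖x‖ ^ 2 / 2) := by gcongr
      _ = Real.exp (2 * ‖x‖ + ‖x‖ ^ 2 / 2) := by rw [← Real.exp_add]; ring_nf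
      _ ≤ _ := by
        apply Real.exp_le_exp.2
        nlinarith [mul_nonneg (norm_nonneg x) (sub_nonneg.2 hx),
          mul_nonneg (sq_nonneg ‖x‖) (sub_nonneg.2 hx)]

lemma norm_elemFactor_sub_one_le (x : ℂ) :
    ‖elemFactor x - 1‖ ≤ 16 * Real.exp (9 * ‖x‖ ^ 3) * ‖x‖ ^ 3 := by
  have h3 : 0 ≤ ‖x‖ ^ 3 := by positivity
  have he : 1 ≤ Real.exp (9 * ‖x‖ ^ 3) := Real.one_le_exp (by positivity)
  rcases le_total ‖x‖ (1 / 2) with hx | hx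
  · obtain ⟨w, hw, hE⟩ := exists_exp_eq_elemFactor hx
    have h1 : ‖x‖ ^ 3 ≤ 1 := pow_le_one₀ (norm_nonneg _) (by linarith)
    rw [hE]
    refine (Complex.norm_exp_sub_one_le (hw.trans h1)).trans ?_
    nlinarith
  · have h1 : ‖elemFactor x - 1‖ ≤ 2 * Real.exp (9 * ‖x‖ ^ 3) := by
      refine (norm_sub_le _ _).trans ?_
      rw [norm_one]
      linarith [norm_elemFactor_le x]
    have h8 : 1 / 8 ≤ ‖x‖ ^ 3 := by
      calc (1 / 8 : ℝ) = (1 / 2) ^ 3 := by norm_num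
        _ ≤ _ := by gcongr
    nlinarith

lemma exists_one_le_exp_mul_norm_elemFactor {α : ℂ} (hα : 0 < α.re) :
    ∃ K : ℝ, 0 ≤ K ∧ ∀ u : ℂ, 0 < u.re →
      1 ≤ Real.exp (K * (1 / ‖u‖) ^ 3) * ‖elemFactor (α / u)‖ := by
  have hα0 : α ≠ 0 := by rintro rfl; simp at hα
  have hn : 0 < ‖α‖ := norm_pos_iff.2 hα0
  set q : ℝ := α.re / (2 * ‖α‖) with hq
  have hq0 : 0 < q := by positivity
  have hq1 : q ≤ 1 := by
    rw [hq, div_le_one (by positivity)]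
    linarith [Complex.re_le_norm α]
  have hlog : 0 ≤ -Real.log q := by linarith [Real.log_nonpos hq0.le hq1]
  refine ⟨(10 + 8 * -Real.log q) * ‖α‖ ^ 3, by positivity, fun u hu => ?_⟩
  have hu0 : u ≠ 0 := by rintro rfl; simp at hu
  have hun : 0 < ‖u‖ := norm_pos_iff.2 hu0
  have hxn : ‖α / u‖ = ‖α‖ / ‖u‖ := norm_div _ _
  set x : ℂ := α / u with hx
  have e : (10 + 8 * -Real.log q) * ‖α‖ ^ 3 * (1 / ‖u‖) ^ 3
      = (10 + 8 * -Real.log q) * ‖x‖ ^ 3 := by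
    rw [hxn]; ring
  rw [e]
  have h3 : 0 ≤ ‖x‖ ^ 3 := by positivity
  have key : Real.exp (-((10 + 8 * -Real.log q) * ‖x‖ ^ 3)) ≤ ‖elemFactor x‖ := by
    rcases le_total ‖x‖ (1 / 2) with hx2 | hx2
    · obtain ⟨w, hw, hE⟩ := exists_exp_eq_elemFactor hx2
      rw [hE, Complex.norm_exp]
      apply Real.exp_le_exp.2
      have := Complex.abs_re_le_norm w
      have := neg_abs_le w.re
      nlinarith
    · have h8 : 1 / 8 ≤ ‖x‖ ^ 3 := by
        calc (1 / 8 : ℝ) = (1 / 2) ^ 3 := by norm_num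
          _ ≤ _ := by gcongr
      have h1 : q ≤ ‖1 + x‖ := by
        have h1 : 1 + x = (u + α) / u := by rw [hx]; field_simp
        have h2 : α.re ≤ ‖u + α‖ := by
          refine le_trans ?_ (Complex.re_le_norm _)
          simp; linarith
        have h4 : ‖u‖ ≤ 2 * ‖α‖ := by
          rw [hxn, div_le_div_iff₀ (by norm_num) hun] at hx2
          linarith
        rw [h1, norm_div, hq]
        gcongr
      have h2 : Real.exp (-(‖x‖ + ‖x‖ ^ 2 / 2)) ≤ ‖Complex.exp (-x + x ^ 2 / 2)‖ := by
        rw [Complex.norm_exp]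
        apply Real.exp_le_exp.2
        have ha : ‖-x + x ^ 2 / 2‖ ≤ ‖x‖ + ‖x‖ ^ 2 / 2 := by
          refine (norm_add_le _ _).trans ?_
          simp
        have hb := Complex.abs_re_le_norm (-x + x ^ 2 / 2)
        linarith [neg_abs_le (-x + x ^ 2 / 2).re]
      rw [elemFactor, norm_mul]
      calc _ ≤ Real.exp (Real.log q + -(‖x‖ + ‖x‖ ^ 2 / 2)) := by
            apply Real.exp_le_exp.2
            nlinarith [mul_nonneg (norm_nonneg x) (sub_nonneg.2 hx2),
              mul_nonneg (sq_nonneg ‖x‖) (sub_nonneg.2 hx2),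
              mul_nonneg hlog (sub_nonneg.2 h8)]
        _ = q * Real.exp (-(‖x‖ + ‖x‖ ^ 2 / 2)) := by rw [Real.exp_add, Real.exp_log hq0]
        _ ≤ _ := by gcongr
  calc (1 : ℝ) = Real.exp ((10 + 8 * -Real.log q) * ‖x‖ ^ 3)
        * Real.exp (-((10 + 8 * -Real.log q) * ‖x‖ ^ 3)) := by
        rw [← Real.exp_add]; simp
    _ ≤ _ := by gcongr

/-- The lattice point `mτ + n`. -/
def latticePt (τ : ℝ) (mn : ℕ × ℕ) : ℝ := mn.1 * τ + mn.2

lemma latticePt_nonneg {τ : ℝ} (hτ : 0 < τ) (mn : ℕ × ℕ) : 0 ≤ latticePt τ mn := by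
  unfold latticePt; positivity

lemma min_mul_max_le_latticePt {τ : ℝ} (hτ : 0 < τ) (mn : ℕ × ℕ) :
    min 1 τ * max (mn.1 : ℝ) mn.2 ≤ latticePt τ mn := by
  unfold latticePt
  have h1 : (0 : ℝ) ≤ mn.1 := by positivity
  have h2 : (0 : ℝ) ≤ mn.2 := by positivity
  have h4 := min_le_left 1 τ
  have h5 := min_le_right 1 τ
  rcases le_total (mn.1 : ℝ) mn.2 with h | h
  · rw [max_eq_right h]; nlinarith
  · rw [max_eq_left h]; nlinarith

lemma latticePt_eq_zero_or_le {τ : ℝ} (hτ : 0 < τ) (mn : ℕ × ℕ) :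
    latticePt τ mn = 0 ∨ min 1 τ ≤ latticePt τ mn := by
  by_cases h : mn = 0
  · left; simp [latticePt, h]
  · right
    have h1 : (1 : ℝ) ≤ max (mn.1 : ℝ) mn.2 := by
      by_contra! hlt
      rw [max_lt_iff] at hlt
      norm_cast at hlt
      exact h (Prod.ext (by simpa using hlt.1) (by simpa using hlt.2))
    have h0 : 0 ≤ min 1 τ := by positivity
    calc min 1 τ ≤ min 1 τ * max (mn.1 : ℝ) mn.2 := le_mul_of_one_le_right h0 h1
      _ ≤ _ := min_mul_max_le_latticePt hτ mn

lemma summable_latticePt_rpow {τ : ℝ} (hτ : 0 < τ) {k : ℝ} (hk : 2 < k) :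
    Summable fun mn : ℕ × ℕ => latticePt τ mn ^ (-k) := by
  have h0 : 0 < min 1 τ := by positivity
  let ι : ℕ × ℕ → (Fin 2 → ℤ) := fun mn => ![mn.1, mn.2]
  have hι : Function.Injective ι := by
    intro x y h
    have h1 := congrFun h 0
    have h2 := congrFun h 1
    simp [ι] at h1 h2
    exact Prod.ext h1 h2
  have hs := ((EisensteinSeries.summable_one_div_norm_rpow hk).comp_injective hι).mul_left
    ((min 1 τ) ^ (-k))
  refine Summable.of_nonneg_of_le (fun mn => Real.rpow_nonneg (latticePt_nonneg hτ mn) _)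
    (fun mn => ?_) hs
  have hn : ‖ι mn‖ = max (mn.1 : ℝ) mn.2 := by
    simp [ι, EisensteinSeries.norm_eq_max_natAbs]
  simp only [Function.comp, hn]
  rw [← Real.mul_rpow h0.le (by positivity)]
  rcases eq_or_ne mn 0 with h | h
  · simp [h, latticePt]
  · have h1 : (0 : ℝ) < max (mn.1 : ℝ) mn.2 := by
      by_contra! hlt
      rw [max_le_iff] at hlt
      norm_cast at hlt
      exact h (Prod.ext (by simpa using hlt.1) (by simpa using hlt.2))
    exact Real.rpow_le_rpow_of_nonpos (by positivity) (min_mul_max_le_latticePt hτ mn) (by linarith)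

lemma summable_elemFactor_bound {τ : ℝ} (hτ : 0 < τ) (C : ℝ) :
    Summable fun mn : ℕ × ℕ => C * latticePt τ mn ^ (-3 : ℝ) :=
  (summable_latticePt_rpow hτ (by norm_num)).mul_left _

/-- Uniform bound for the Weierstrass factors on a disc. -/
lemma norm_elemFactor_div_sub_one_le {τ : ℝ} (hτ : 0 < τ) {R : ℝ} {x : ℂ} (hx : ‖x‖ ≤ R)
    (mn : ℕ × ℕ) :
    ‖elemFactor (x / latticePt τ mn) - 1‖ ≤
      16 * Real.exp (9 * (R / min 1 τ) ^ 3) * R ^ 3 * latticePt τ mn ^ (-3 : ℝ) := by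
  have hR : 0 ≤ R := (norm_nonneg _).trans hx
  have h0 : 0 < min 1 τ := by positivity
  have hl := latticePt_nonneg hτ mn
  rcases latticePt_eq_zero_or_le hτ mn with h | h
  · rw [h]
    simp only [ofReal_zero, div_zero, elemFactor_zero, sub_self, norm_zero]
    positivity
  · have hpos : 0 < latticePt τ mn := h0.trans_le h
    refine (norm_elemFactor_sub_one_le _).trans ?_
    have hn : ‖x / (latticePt τ mn : ℂ)‖ = ‖x‖ / latticePt τ mn := by
      rw [norm_div, Complex.norm_real, Real.norm_of_nonneg hl]
    have e : latticePt τ mn ^ (-3 : ℝ) = (1 / latticePt τ mn) ^ 3 := by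
      rw [Real.rpow_neg hl, one_div, inv_pow]
      norm_cast
    rw [hn, e]
    calc _ ≤ 16 * Real.exp (9 * (R / min 1 τ) ^ 3) * (R / latticePt τ mn) ^ 3 := by gcongr
      _ = _ := by ring

lemma elemFactor_latticePt (τ : ℝ) (z : ℂ) (mn : ℕ × ℕ) :
    (if mn = (0, 0) then 1
      else (1 + z / (mn.1 * (τ : ℂ) + mn.2)) *
        Complex.exp (-(z / (mn.1 * (τ : ℂ) + mn.2)) +
          z ^ 2 / (2 * ((mn.1 : ℂ) * (τ : ℂ) + (mn.2 : ℂ)) ^ 2)))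
      = elemFactor (z / latticePt τ mn) := by
  split_ifs with h
  · simp [h, latticePt, elemFactor_zero]
  · simp only [elemFactor, latticePt]
    push_cast
    congr 3
    rw [div_pow, div_div, mul_comm (2 : ℂ)]

/-- The infinite product in the definition of `barnesG`. -/
def latticeProd (τ : ℝ) (z : ℂ) : ℂ := ∏' mn : ℕ × ℕ, elemFactor (z / latticePt τ mn)

lemma barnesG_eq (τ : ℝ) (z : ℂ) :
    barnesG z τ = z / τ * Complex.exp (aBarnes τ * z / τ + bBarnes τ * z ^ 2 / (2 * τ)) *
      latticeProd τ z := by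
  simp only [barnesG, latticeProd, elemFactor_latticePt]

lemma summable_norm_elemFactor_sub_one {τ : ℝ} (hτ : 0 < τ) (z : ℂ) :
    Summable fun mn : ℕ × ℕ => ‖elemFactor (z / latticePt τ mn) - 1‖ :=
  Summable.of_nonneg_of_le (fun _ => norm_nonneg _)
    (fun mn => norm_elemFactor_div_sub_one_le hτ le_rfl mn) (summable_elemFactor_bound hτ _)

lemma hasProd_latticeProd {τ : ℝ} (hτ : 0 < τ) (z : ℂ) :
    HasProd (fun mn : ℕ × ℕ => elemFactor (z / latticePt τ mn)) (latticeProd τ z) := by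
  have := multipliable_one_add_of_summable (summable_norm_elemFactor_sub_one hτ z)
  simp only [add_sub_cancel] at this
  exact this.hasProd

lemma latticeProd_ne_zero {τ : ℝ} (hτ : 0 < τ) {z : ℂ} (hz : 0 < z.re) :
    latticeProd τ z ≠ 0 := by
  have := tprod_one_add_ne_zero_of_summable
    (f := fun mn : ℕ × ℕ => elemFactor (z / latticePt τ mn) - 1) (fun mn => ?_)
    (summable_norm_elemFactor_sub_one hτ z)
  · simpa only [add_sub_cancel, latticeProd] using this
  · rw [add_sub_cancel, elemFactor]
    refine mul_ne_zero (fun h => ?_) (Complex.exp_ne_zero _)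
    have h1 := congrArg Complex.re h
    rw [Complex.add_re, Complex.div_ofReal_re] at h1
    have : 0 ≤ z.re / latticePt τ mn := div_nonneg hz.le (latticePt_nonneg hτ mn)
    simp at h1
    linarith

lemma differentiable_latticeProd {τ : ℝ} (hτ : 0 < τ) : Differentiable ℂ (latticeProd τ) := by
  intro z
  have hz : z ∈ Metric.ball (0 : ℂ) (‖z‖ + 1) := by simp
  have hu := summable_elemFactor_bound hτ
    (16 * Real.exp (9 * ((‖z‖ + 1) / min 1 τ) ^ 3) * (‖z‖ + 1) ^ 3)
  have hcont : ∀ mn : ℕ × ℕ, Differentiable ℂ fun x : ℂ => elemFactor (x / latticePt τ mn) - 1 :=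
    fun mn => (differentiable_elemFactor.comp (differentiable_id.div_const _)).sub_const 1
  have h := Summable.hasProdLocallyUniformlyOn_one_add
    (f := fun (mn : ℕ × ℕ) (x : ℂ) => elemFactor (x / latticePt τ mn) - 1)
    (K := Metric.ball (0 : ℂ) (‖z‖ + 1)) Metric.isOpen_ball hu
    (Eventually.of_forall fun mn x hx =>
      norm_elemFactor_div_sub_one_le hτ (by simpa using (mem_ball_zero_iff.1 hx).le) mn)
    (fun mn => (hcont mn).continuous.continuousOn)
  rw [hasProdLocallyUniformlyOn_iff_tendstoLocallyUniformlyOn] at h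
  have hd := h.differentiableOn (Eventually.of_forall fun s => ?_) Metric.isOpen_ball
  · simp only [add_sub_cancel] at hd
    exact hd.differentiableAt (Metric.isOpen_ball.mem_nhds hz)
  · apply DifferentiableOn.fun_finsetProd
    intro mn _
    exact ((hcont mn).const_add 1).differentiableOn

lemma differentiable_barnesG {τ : ℝ} (hτ : 0 < τ) :
    Differentiable ℂ fun z : ℂ => barnesG z τ := by
  simp only [barnesG_eq]
  have := differentiable_latticeProd hτ
  fun_prop

lemma barnesG_ne_zero {τ : ℝ} (hτ : 0 < τ) {z : ℂ} (hz : 0 < z.re) : barnesG z τ ≠ 0 := by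
  rw [barnesG_eq]
  have hz0 : z ≠ 0 := by rintro rfl; simp at hz
  have hτ0 : (τ : ℂ) ≠ 0 := by exact_mod_cast hτ.ne'
  exact mul_ne_zero (mul_ne_zero (div_ne_zero hz0 hτ0) (Complex.exp_ne_zero _))
    (latticeProd_ne_zero hτ hz)

lemma elemFactor_shift {l : ℝ} {v β : ℂ} (hl : 0 < l) (hu : (l : ℂ) + v ≠ 0) :
    elemFactor ((β + v) / l) = elemFactor (β / (l + v)) *
      ((l + v) / l * Complex.exp (-v / l + v ^ 2 / (2 * l ^ 2))) *
      Complex.exp (β * (1 / (l + v) - 1 / l + v / l ^ 2) +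
        β ^ 2 * (1 / 2 * (1 / l ^ 2 - 1 / (l + v) ^ 2))) := by
  have hl0 : (l : ℂ) ≠ 0 := by exact_mod_cast hl.ne'
  simp only [elemFactor]
  have e1 : 1 + (β + v) / l = (1 + β / (l + v)) * ((l + v) / l) := by
    field_simp
    ring
  have e2 : -((β + v) / l) + ((β + v) / l) ^ 2 / 2 =
      (-(β / (l + v)) + (β / (l + v)) ^ 2 / 2) + (-v / l + v ^ 2 / (2 * l ^ 2)) +
      (β * (1 / (l + v) - 1 / l + v / l ^ 2) +
        β ^ 2 * (1 / 2 * (1 / l ^ 2 - 1 / (l + v) ^ 2))) := by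
    field_simp
    ring
  rw [e1, e2, Complex.exp_add, Complex.exp_add]
  ring

lemma max_le_norm_ofReal_add {l : ℝ} {v : ℂ} (hl : 0 ≤ l) (hv : 0 ≤ v.re) :
    max l ‖v‖ ≤ ‖(l : ℂ) + v‖ := by
  apply max_le
  · refine le_trans ?_ (Complex.re_le_norm _)
    simpa using hv
  · rw [← sq_le_sq₀ (norm_nonneg _) (norm_nonneg _), Complex.sq_norm, Complex.sq_norm,
      Complex.normSq_apply, Complex.normSq_apply]
    simp only [Complex.add_re, Complex.add_im, Complex.ofReal_re, Complex.ofReal_im, zero_add]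
    nlinarith [mul_nonneg hl hv]

lemma norm_inv_sq_sub_inv_sq_le {l : ℝ} {v : ℂ} (hl : 0 < l) (hv : 0 ≤ v.re) :
    ‖1 / (l : ℂ) ^ 2 - 1 / ((l : ℂ) + v) ^ 2‖ ≤ 2 * √‖v‖ * l ^ (-(5 / 2) : ℝ) := by
  have hm := max_le_norm_ofReal_add hl.le hv
  have h1 : l ≤ ‖(l : ℂ) + v‖ := (le_max_left _ _).trans hm
  have h2 : ‖v‖ ≤ ‖(l : ℂ) + v‖ := (le_max_right _ _).trans hm
  set U := ‖(l : ℂ) + v‖ with hU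
  have hU0 : 0 < U := hl.trans_le h1
  have hu : (l : ℂ) + v ≠ 0 := norm_pos_iff.1 hU0
  have hl0 : (l : ℂ) ≠ 0 := by exact_mod_cast hl.ne'
  have e : 1 / (l : ℂ) ^ 2 - 1 / ((l : ℂ) + v) ^ 2
      = v * (l + (l + v)) / (l ^ 2 * (l + v) ^ 2) := by
    field_simp
    ring
  have hln : ‖(l : ℂ)‖ = l := by rw [Complex.norm_real, Real.norm_of_nonneg hl.le]
  have h3 : ‖(l : ℂ) + (l + v)‖ ≤ 2 * U := by
    refine (norm_add_le _ _).trans ?_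
    rw [hln]; linarith
  have h4 : √l * √‖v‖ ≤ U := by
    rw [← Real.sqrt_mul hl.le]
    refine Real.sqrt_le_iff.2 ⟨hU0.le, ?_⟩
    rw [sq]
    gcongr
  have h5 : l ^ (-(5 / 2) : ℝ) = 1 / (l ^ 2 * √l) := by
    rw [Real.rpow_neg hl.le, one_div, Real.sqrt_eq_rpow, ← Real.rpow_natCast l 2,
      ← Real.rpow_add hl]
    norm_num
  rw [e, norm_div, norm_mul, norm_mul, norm_pow, norm_pow, hln, ← hU, h5]
  have hsl : 0 < √l := Real.sqrt_pos.2 hl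
  calc ‖v‖ * ‖(l : ℂ) + (l + v)‖ / (l ^ 2 * U ^ 2) ≤ ‖v‖ * (2 * U) / (l ^ 2 * U ^ 2) := by gcongr
    _ = 2 * ‖v‖ / (l ^ 2 * U) := by field_simp
    _ ≤ 2 * √‖v‖ * (1 / (l ^ 2 * √l)) := by
      rw [mul_one_div, div_le_div_iff₀ (by positivity) (by positivity)]
      have h6 : ‖v‖ * √l ≤ √‖v‖ * U := by
        calc ‖v‖ * √l = √‖v‖ * (√l * √‖v‖) := by
              nth_rewrite 1 [← Real.mul_self_sqrt (norm_nonneg v)]; ring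
          _ ≤ _ := by gcongr
      nlinarith [mul_le_mul_of_nonneg_left h6 (sq_nonneg l)]

/-- Termwise comparison of the products of Weierstrass factors. -/
lemma exists_norm_prod_elemFactor_le {p : ℕ} {τ : ℝ} (hτ : 0 < τ) (α β : Fin p → ℂ)
    (hsum : ∑ j, α j = ∑ j, β j) (hα : ∀ j, 0 < (α j).re) :
    ∃ K : ℝ, 0 ≤ K ∧ ∀ v : ℂ, 0 ≤ v.re → ∀ mn : ℕ × ℕ,
      ‖∏ j, elemFactor ((β j + v) / latticePt τ mn)‖ ≤
        Real.exp (K * (1 + √‖v‖) * latticePt τ mn ^ (-(5 / 2) : ℝ)) *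
          ‖∏ j, elemFactor ((α j + v) / latticePt τ mn)‖ := by
  choose Kα hKα0 hKα using fun j => exists_one_le_exp_mul_norm_elemFactor (hα j)
  set κ : ℂ := 1 / 2 * (∑ j, (β j) ^ 2 - ∑ j, (α j) ^ 2) with hκ
  set B : ℝ := ∑ j, (9 * ‖β j‖ ^ 3) + ∑ j, Kα j with hB
  have hB0 : 0 ≤ B :=
    add_nonneg (Finset.sum_nonneg fun j _ => by positivity) (Finset.sum_nonneg fun j _ => hKα0 j)
  have h0 : 0 < min 1 τ := by positivity
  refine ⟨B * (min 1 τ) ^ (-(1 / 2) : ℝ) + 2 * ‖κ‖, by positivity, fun v hv mn => ?_⟩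
  set l := latticePt τ mn with hldef
  rcases latticePt_eq_zero_or_le hτ mn with hl | hl
  · rw [hldef, hl]
    simp only [ofReal_zero, div_zero, elemFactor_zero, Finset.prod_const_one, norm_one, mul_one]
    exact Real.one_le_exp (by positivity)
  rw [← hldef] at hl
  have hl0 : 0 < l := h0.trans_le hl
  have h1 : l ≤ ‖(l : ℂ) + v‖ := (le_max_left _ _).trans (max_le_norm_ofReal_add hl0.le hv)
  have hu : (l : ℂ) + v ≠ 0 := norm_pos_iff.1 (hl0.trans_le h1)
  have hure : 0 < ((l : ℂ) + v).re := by simp; linarith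
  set u : ℂ := (l : ℂ) + v
  set A : ℂ := (l + v) / l * Complex.exp (-v / l + v ^ 2 / (2 * l ^ 2))
  set x : ℂ := 1 / (l + v) - 1 / l + v / l ^ 2
  set y : ℂ := 1 / l ^ 2 - 1 / (l + v) ^ 2
  have hprod : ∀ γ : Fin p → ℂ, ∏ j, elemFactor ((γ j + v) / l) =
      (∏ j, elemFactor (γ j / u)) * A ^ p *
        Complex.exp ((∑ j, γ j) * x + (∑ j, (γ j) ^ 2) * (1 / 2 * y)) := by
    intro γ
    rw [Finset.sum_mul, Finset.sum_mul, ← Finset.sum_add_distrib, Complex.exp_sum]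
    have : A ^ p = ∏ _j : Fin p, A := by simp
    rw [this, ← Finset.prod_mul_distrib, ← Finset.prod_mul_distrib]
    exact Finset.prod_congr rfl fun j _ => elemFactor_shift hl0 hu
  have hexp : Complex.exp ((∑ j, β j) * x + (∑ j, (β j) ^ 2) * (1 / 2 * y)) =
      Complex.exp (κ * y) * Complex.exp ((∑ j, α j) * x + (∑ j, (α j) ^ 2) * (1 / 2 * y)) := by
    rw [← Complex.exp_add, hsum, hκ]
    ring_nf
  rw [hprod β, hprod α, hexp]
  simp only [norm_mul]
  set E := ‖Complex.exp ((∑ j, α j) * x + (∑ j, (α j) ^ 2) * (1 / 2 * y))‖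
  have hβ : ‖∏ j, elemFactor (β j / u)‖ ≤ Real.exp ((∑ j, 9 * ‖β j‖ ^ 3) * (1 / ‖u‖) ^ 3) := by
    rw [norm_prod, Finset.sum_mul, Real.exp_sum]
    refine Finset.prod_le_prod (fun _ _ => norm_nonneg _) fun j _ => ?_
    refine (norm_elemFactor_le _).trans (le_of_eq ?_)
    rw [norm_div]; ring_nf
  have hα' : 1 ≤ Real.exp ((∑ j, Kα j) * (1 / ‖u‖) ^ 3) * ‖∏ j, elemFactor (α j / u)‖ := by
    rw [norm_prod, Finset.sum_mul, Real.exp_sum, ← Finset.prod_mul_distrib]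
    simpa using Finset.prod_le_prod (s := Finset.univ) (f := fun _ : Fin p => (1 : ℝ))
      (fun _ _ => zero_le_one) fun j _ => hKα j u hure
  have hB' : ‖∏ j, elemFactor (β j / u)‖ ≤
      Real.exp (B * (1 / ‖u‖) ^ 3) * ‖∏ j, elemFactor (α j / u)‖ := by
    calc _ ≤ Real.exp ((∑ j, 9 * ‖β j‖ ^ 3) * (1 / ‖u‖) ^ 3) * 1 := by rwa [mul_one]
      _ ≤ Real.exp ((∑ j, 9 * ‖β j‖ ^ 3) * (1 / ‖u‖) ^ 3) *
        (Real.exp ((∑ j, Kα j) * (1 / ‖u‖) ^ 3) * ‖∏ j, elemFactor (α j / u)‖) := by gcongr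
      _ = _ := by rw [← mul_assoc, ← Real.exp_add, hB, ← add_mul]
  have hκy : ‖Complex.exp (κ * y)‖ ≤
      Real.exp (2 * ‖κ‖ * √‖v‖ * l ^ (-(5 / 2) : ℝ)) := by
    refine (Complex.norm_exp_le_exp_norm _).trans (Real.exp_le_exp.2 ?_)
    rw [norm_mul]
    calc _ ≤ ‖κ‖ * (2 * √‖v‖ * l ^ (-(5 / 2) : ℝ)) := by
          gcongr
          exact norm_inv_sq_sub_inv_sq_le hl0 hv
      _ = _ := by ring
  have hu3 : (1 / ‖u‖) ^ 3 ≤ (min 1 τ) ^ (-(1 / 2) : ℝ) * l ^ (-(5 / 2) : ℝ) := by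
    calc (1 / ‖u‖) ^ 3 ≤ (1 / l) ^ 3 := by gcongr
      _ = l ^ (-(1 / 2) : ℝ) * l ^ (-(5 / 2) : ℝ) := by
        rw [← Real.rpow_add hl0, one_div, inv_pow, ← Real.rpow_natCast, ← Real.rpow_neg hl0.le]
        norm_num
      _ ≤ _ := by
        gcongr ?_ * _
        exact Real.rpow_le_rpow_of_nonpos h0 hl (by norm_num)
  have hw : 0 ≤ l ^ (-(5 / 2) : ℝ) := by positivity
  have hm : 0 ≤ (min 1 τ) ^ (-(1 / 2) : ℝ) := by positivity
  have hs : 0 ≤ √‖v‖ := Real.sqrt_nonneg _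
  have hfin : B * (1 / ‖u‖) ^ 3 + 2 * ‖κ‖ * √‖v‖ * l ^ (-(5 / 2) : ℝ) ≤
      (B * (min 1 τ) ^ (-(1 / 2) : ℝ) + 2 * ‖κ‖) * (1 + √‖v‖) * l ^ (-(5 / 2) : ℝ) := by
    have h2 : B * (1 / ‖u‖) ^ 3 ≤ B * ((min 1 τ) ^ (-(1 / 2) : ℝ) * l ^ (-(5 / 2) : ℝ)) := by
      gcongr
    have h3 : 0 ≤ B * (min 1 τ) ^ (-(1 / 2) : ℝ) * √‖v‖ * l ^ (-(5 / 2) : ℝ) := by positivity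
    have h4 : 0 ≤ 2 * ‖κ‖ * l ^ (-(5 / 2) : ℝ) := by positivity
    nlinarith
  calc _ ≤ Real.exp (B * (1 / ‖u‖) ^ 3) * ‖∏ j, elemFactor (α j / u)‖ * ‖A ^ p‖ *
        (Real.exp (2 * ‖κ‖ * √‖v‖ * l ^ (-(5 / 2) : ℝ)) * E) := by gcongr
    _ = Real.exp (B * (1 / ‖u‖) ^ 3 + 2 * ‖κ‖ * √‖v‖ * l ^ (-(5 / 2) : ℝ)) *
        (‖∏ j, elemFactor (α j / u)‖ * ‖A ^ p‖ * E) := by rw [Real.exp_add]; ring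
    _ ≤ _ := by gcongr

lemma exists_norm_prod_latticeProd_le {p : ℕ} {τ : ℝ} (hτ : 0 < τ) (α β : Fin p → ℂ)
    (hsum : ∑ j, α j = ∑ j, β j) (hα : ∀ j, 0 < (α j).re) :
    ∃ K : ℝ, 0 ≤ K ∧ ∀ v : ℂ, 0 ≤ v.re →
      ‖∏ j, latticeProd τ (β j + v)‖ ≤
        Real.exp (K * (1 + √‖v‖)) * ‖∏ j, latticeProd τ (α j + v)‖ := by
  obtain ⟨K, hK0, hK⟩ := exists_norm_prod_elemFactor_le hτ α β hsum hα
  have hs := summable_latticePt_rpow hτ (k := 5 / 2) (by norm_num)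
  have hwt : ∀ mn, 0 ≤ latticePt τ mn ^ (-(5 / 2) : ℝ) := fun mn =>
    Real.rpow_nonneg (latticePt_nonneg hτ mn) _
  refine ⟨K * ∑' mn, latticePt τ mn ^ (-(5 / 2) : ℝ), mul_nonneg hK0 (tsum_nonneg hwt),
    fun v hv => ?_⟩
  have hprod : ∀ γ : Fin p → ℂ, HasProd
      (fun mn : ℕ × ℕ => ∏ j, elemFactor ((γ j + v) / latticePt τ mn))
      (∏ j, latticeProd τ (γ j + v)) := fun γ =>
    hasProd_prod fun j _ => hasProd_latticeProd hτ (γ j + v)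
  refine le_of_tendsto_of_tendsto (hprod β).norm ((hprod α).norm.const_mul _)
    (Eventually.of_forall fun S => ?_)
  calc _ ≤ ∏ mn ∈ S, (Real.exp (K * (1 + √‖v‖) * latticePt τ mn ^ (-(5 / 2) : ℝ)) *
          ‖∏ j, elemFactor ((α j + v) / latticePt τ mn)‖) :=
        Finset.prod_le_prod (fun _ _ => norm_nonneg _) fun mn _ => hK v hv mn
    _ = Real.exp (K * (1 + √‖v‖) * ∑ mn ∈ S, latticePt τ mn ^ (-(5 / 2) : ℝ)) *
          ∏ mn ∈ S, ‖∏ j, elemFactor ((α j + v) / latticePt τ mn)‖ := by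
        rw [Finset.prod_mul_distrib, Finset.mul_sum, Real.exp_sum]
    _ ≤ _ := by
        have h1 := hs.sum_le_tsum S fun mn _ => hwt mn
        have h2 : 0 ≤ K * (1 + √‖v‖) := by positivity
        refine mul_le_mul_of_nonneg_right (Real.exp_le_exp.2 ?_)
          (Finset.prod_nonneg fun _ _ => norm_nonneg _)
        calc _ ≤ K * (1 + √‖v‖) * ∑' mn, latticePt τ mn ^ (-(5 / 2) : ℝ) := by gcongr
          _ = _ := by ring

/-- The ratio of double gamma functions grows subexponentially in the right half-plane. -/
lemma exists_norm_barnesG_ratio_le {p : ℕ} {τ : ℝ} (hτ : 0 < τ) (α β : Fin p → ℂ)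
    (hsum : ∑ j, α j = ∑ j, β j) (hα : ∀ j, 0 < (α j).re) :
    ∃ M K : ℝ, 0 ≤ M ∧ 0 ≤ K ∧ ∀ v : ℂ, 0 ≤ v.re →
      ‖(∏ j, barnesG (β j + v) τ) / ∏ j, barnesG (α j + v) τ‖ ≤
        M * Real.exp (K * √‖v‖) := by
  obtain ⟨K, hK0, hK⟩ := exists_norm_prod_latticeProd_le hτ α β hsum hα
  set κ : ℂ := bBarnes τ / (2 * τ) * (∑ j, (β j) ^ 2 - ∑ j, (α j) ^ 2) with hκ
  have hQ : 0 ≤ ∏ j, (1 + ‖β j - α j‖ / (α j).re) :=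
    Finset.prod_nonneg fun j _ => by have := hα j; positivity
  refine ⟨‖Complex.exp κ‖ * (∏ j, (1 + ‖β j - α j‖ / (α j).re)) * Real.exp K, K,
    by positivity, hK0, fun v hv => ?_⟩
  have hre : ∀ j, (α j).re ≤ (α j + v).re := fun j => by simpa using hv
  have hre0 : ∀ j, 0 < (α j + v).re := fun j => (hα j).trans_le (hre j)
  have hprod : ∀ γ : Fin p → ℂ, ∏ j, barnesG (γ j + v) τ =
      (∏ j, (γ j + v)) * (∏ j, latticeProd τ (γ j + v)) *
      ((1 / (τ : ℂ)) ^ p * Complex.exp (p * (bBarnes τ / (2 * τ) * v ^ 2 + aBarnes τ / τ * v)) *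
        Complex.exp ((aBarnes τ / τ + bBarnes τ / τ * v) * (∑ j, γ j) +
          bBarnes τ / (2 * τ) * ∑ j, (γ j) ^ 2)) := by
    intro γ
    rw [mul_assoc ((1 / (τ : ℂ)) ^ p), ← Complex.exp_add]
    have h1 : (1 / (τ : ℂ)) ^ p = ∏ _j : Fin p, 1 / (τ : ℂ) := by simp
    have h2 : p * (bBarnes τ / (2 * τ) * v ^ 2 + aBarnes τ / τ * v) =
        ∑ _j : Fin p, (bBarnes τ / (2 * τ) * v ^ 2 + aBarnes τ / τ * v) := by
      rw [Finset.sum_const, Finset.card_univ, Fintype.card_fin, nsmul_eq_mul]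
    rw [h1, h2, Finset.mul_sum, Finset.mul_sum, ← Finset.sum_add_distrib, ← Finset.sum_add_distrib,
      Complex.exp_sum, ← Finset.prod_mul_distrib, ← Finset.prod_mul_distrib,
      ← Finset.prod_mul_distrib]
    refine Finset.prod_congr rfl fun j _ => ?_
    have e : aBarnes τ * (γ j + v) / τ + bBarnes τ * (γ j + v) ^ 2 / (2 * τ) =
        bBarnes τ / (2 * τ) * v ^ 2 + aBarnes τ / τ * v +
        ((aBarnes τ / τ + bBarnes τ / τ * v) * γ j + bBarnes τ / (2 * τ) * γ j ^ 2) := by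
      ring
    rw [barnesG_eq, e]
    ring
  have hexp : Complex.exp ((aBarnes τ / τ + bBarnes τ / τ * v) * (∑ j, β j) +
        bBarnes τ / (2 * τ) * ∑ j, (β j) ^ 2) = Complex.exp κ *
      Complex.exp ((aBarnes τ / τ + bBarnes τ / τ * v) * (∑ j, α j) +
        bBarnes τ / (2 * τ) * ∑ j, (α j) ^ 2) := by
    rw [← Complex.exp_add, hκ, hsum]
    ring_nf
  have hne : ∏ j, barnesG (α j + v) τ ≠ 0 :=
    Finset.prod_ne_zero_iff.2 fun j _ => barnesG_ne_zero hτ (hre0 j)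
  have hlin : ‖∏ j, (β j + v)‖ ≤
      (∏ j, (1 + ‖β j - α j‖ / (α j).re)) * ‖∏ j, (α j + v)‖ := by
    rw [norm_prod, norm_prod, ← Finset.prod_mul_distrib]
    refine Finset.prod_le_prod (fun _ _ => norm_nonneg _) fun j _ => ?_
    have h1 : (α j).re ≤ ‖α j + v‖ := (hre j).trans (Complex.re_le_norm _)
    have h2 : ‖β j - α j‖ ≤ ‖β j - α j‖ / (α j).re * ‖α j + v‖ := by
      rw [div_mul_eq_mul_div, le_div_iff₀ (hα j)]
      gcongr
    calc ‖β j + v‖ = ‖(α j + v) + (β j - α j)‖ := by ring_nf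
      _ ≤ ‖α j + v‖ + ‖β j - α j‖ := norm_add_le _ _
      _ ≤ _ := by linarith
  rw [norm_div, div_le_iff₀ (norm_pos_iff.2 hne), hprod α, hprod β, hexp]
  simp only [norm_mul]
  have := hK v hv
  calc _ ≤ ((∏ j, (1 + ‖β j - α j‖ / (α j).re)) * ‖∏ j, (α j + v)‖) *
        (Real.exp (K * (1 + √‖v‖)) * ‖∏ j, latticeProd τ (α j + v)‖) * _ := by gcongr
    _ = _ := by rw [mul_add, mul_one, Real.exp_add]; ring

lemma tendsto_exp_mul_exp_neg_exp {μ : ℝ} (hμ : 0 < μ) :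
    Tendsto (fun x : ℝ => Real.exp x * Real.exp (-μ * Real.exp x)) atTop (nhds 0) := by
  have h := Real.tendsto_pow_mul_exp_neg_atTop_nhds_zero 1
  have h2 := (h.comp ((Real.tendsto_exp_atTop).const_mul_atTop hμ)).const_mul (1 / μ)
  rw [mul_zero] at h2
  refine h2.congr fun x => ?_
  simp only [Function.comp, pow_one]
  field_simp

/-- Change of variables `t = e^x` on a ray. -/
lemma integral_ray_eq {f : ℂ → ℂ} {θ : ℝ}
    (hf : IntegrableOn (fun t : ℝ => f (t * Complex.exp (θ * Complex.I))) (Set.Ioi 0)) :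
    Integrable (fun x : ℝ => f (Complex.exp (x + θ * Complex.I)) *
      Complex.exp (x + θ * Complex.I)) ∧
    ∫ x : ℝ, f (Complex.exp (x + θ * Complex.I)) * Complex.exp (x + θ * Complex.I) =
      Complex.exp (θ * Complex.I) * ∫ t in Set.Ioi (0 : ℝ), f (t * Complex.exp (θ * Complex.I)) := by
  have hd : ∀ x ∈ (Set.univ : Set ℝ), HasDerivWithinAt Real.exp (Real.exp x) Set.univ x :=
    fun x _ => (Real.hasDerivAt_exp x).hasDerivWithinAt
  have himg : Real.exp '' Set.univ = Set.Ioi 0 := by rw [Set.image_univ, Real.range_exp]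
  have e : ∀ x : ℝ, f (Complex.exp (x + θ * Complex.I)) * Complex.exp (x + θ * Complex.I) =
      Complex.exp (θ * Complex.I) *
        (|Real.exp x| • f ((Real.exp x : ℝ) * Complex.exp (θ * Complex.I))) := by
    intro x
    rw [abs_of_pos (Real.exp_pos x), Complex.real_smul, Complex.exp_add, Complex.ofReal_exp]
    ring
  simp_rw [e]
  have h1 := integrableOn_image_iff_integrableOn_abs_deriv_smul MeasurableSet.univ hd
    Real.exp_injective.injOn (fun t : ℝ => f (t * Complex.exp (θ * Complex.I)))
  have h2 := integral_image_eq_integral_abs_deriv_smul MeasurableSet.univ hd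
    Real.exp_injective.injOn (fun t : ℝ => f (t * Complex.exp (θ * Complex.I)))
  rw [himg] at h1 h2
  rw [h2, integral_const_mul, setIntegral_univ]
  exact ⟨(integrableOn_univ.1 (h1.1 hf)).const_mul _, rfl⟩

/-- Rotation of the ray of integration for a holomorphic function decaying exponentially in a
sector. -/
lemma integral_ray_rotate {f : ℂ → ℂ} {ε M μ : ℝ} (hε : 0 < ε) (hε2 : ε < Real.pi / 2)
    (hM : 0 ≤ M) (hμ : 0 < μ) (hf : DifferentiableOn ℂ f {v | 0 < v.re})
    (hb : ∀ r θ : ℝ, 0 < r → |θ| ≤ ε →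
      ‖f (r * Complex.exp (θ * Complex.I))‖ ≤ M * Real.exp (-μ * r)) :
    IntegrableOn (fun t : ℝ => f (t * Complex.exp (ε * Complex.I))) (Set.Ioi 0) ∧
    IntegrableOn (fun t : ℝ => f (t * Complex.exp (-(ε * Complex.I)))) (Set.Ioi 0) ∧
    Complex.exp (ε * Complex.I) * ∫ t in Set.Ioi (0 : ℝ), f (t * Complex.exp (ε * Complex.I)) =
      Complex.exp (-(ε * Complex.I)) *
        ∫ t in Set.Ioi (0 : ℝ), f (t * Complex.exp (-(ε * Complex.I))) := by
  have hre : ∀ r θ : ℝ, 0 < r → |θ| ≤ ε → 0 < ((r : ℂ) * Complex.exp (θ * Complex.I)).re := by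
    intro r θ hr hθ
    rw [Complex.re_ofReal_mul, Complex.exp_ofReal_mul_I_re]
    refine mul_pos hr (Real.cos_pos_of_mem_Ioo ⟨?_, ?_⟩)
    · linarith [(abs_le.1 hθ).1]
    · linarith [(abs_le.1 hθ).2]
  have hint : ∀ θ : ℝ, |θ| ≤ ε →
      IntegrableOn (fun t : ℝ => f (t * Complex.exp (θ * Complex.I))) (Set.Ioi 0) := by
    intro θ hθ
    refine Integrable.mono' ((exp_neg_integrableOn_Ioi 0 hμ).const_mul M) ?_ ?_
    · refine ContinuousOn.aestronglyMeasurable ?_ measurableSet_Ioi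
      exact hf.continuousOn.comp (by fun_prop) fun t ht => hre t θ ht hθ
    · filter_upwards [ae_restrict_mem measurableSet_Ioi] with t ht
      exact hb t θ ht hθ
  have hneg : ((-ε : ℝ) : ℂ) * Complex.I = -(ε * Complex.I) := by push_cast; ring
  have hε' : |ε| ≤ ε := (abs_of_pos hε).le
  have hε'' : |-ε| ≤ ε := by rw [abs_neg]; exact hε'
  have hp := integral_ray_eq (hint ε hε')
  have hm := integral_ray_eq (hint (-ε) hε'')
  rw [← hneg]
  refine ⟨hint ε hε', hint (-ε) hε'', ?_⟩
  rw [← hp.2, ← hm.2]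
  set g : ℂ → ℂ := fun ζ => f (Complex.exp ζ) * Complex.exp ζ with hg
  have hexp : ∀ x y : ℝ, Complex.exp (x + y * Complex.I) =
      (Real.exp x : ℝ) * Complex.exp (y * Complex.I) := by
    intro x y
    rw [Complex.exp_add, Complex.ofReal_exp]
  have hgb : ∀ x y : ℝ, |y| ≤ ε →
      ‖g (x + y * Complex.I)‖ ≤ M * (Real.exp x * Real.exp (-μ * Real.exp x)) := by
    intro x y hy
    simp only [hg]
    rw [norm_mul, hexp, norm_mul _ (Complex.exp (y * Complex.I)), Complex.norm_exp_ofReal_mul_I,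
      mul_one, Complex.norm_real, Real.norm_of_nonneg (Real.exp_pos x).le]
    have := hb (Real.exp x) y (Real.exp_pos x) hy
    calc _ ≤ M * Real.exp (-μ * Real.exp x) * Real.exp x := by gcongr
      _ = _ := by ring
  have hvert : ∀ x : ℝ, ‖∫ y in (-ε)..ε, g (x + y * Complex.I)‖ ≤
      M * (Real.exp x * Real.exp (-μ * Real.exp x)) * (2 * ε) := by
    intro x
    refine (intervalIntegral.norm_integral_le_of_norm_le_const fun y hy => hgb x y ?_).trans_eq ?_
    · rw [Set.uIoc_of_le (by linarith)] at hy
      exact abs_le.2 ⟨hy.1.le, hy.2⟩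
    · rw [sub_neg_eq_add, abs_of_pos (by linarith)]; ring
  have hrect : ∀ R : ℝ, 0 < R →
      (∫ x in (-R)..R, g (x + (-ε : ℝ) * Complex.I)) - (∫ x in (-R)..R, g (x + ε * Complex.I)) =
      Complex.I * (∫ y in (-ε)..ε, g ((-R : ℝ) + y * Complex.I)) -
        Complex.I * ∫ y in (-ε)..ε, g (R + y * Complex.I) := by
    intro R hR
    have hd : DifferentiableOn ℂ g (Set.uIcc (-R) R ×ℂ Set.uIcc (-ε) ε) := by
      refine DifferentiableOn.mul (hf.comp (by fun_prop) fun ζ hζ => ?_) (by fun_prop)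
      have hi : |ζ.im| ≤ ε := by
        have := hζ.2
        rw [Set.mem_preimage, Set.uIcc_of_le (by linarith)] at this
        exact abs_le.2 this
      have := hre (Real.exp ζ.re) ζ.im (Real.exp_pos _) hi
      rwa [← hexp, Complex.re_add_im] at this
    have h := Complex.integral_boundary_rect_eq_zero_of_differentiableOn g
      (⟨-R, -ε⟩ : ℂ) (⟨R, ε⟩ : ℂ) hd
    simp only [smul_eq_mul] at h
    linear_combination h
  have hR : Tendsto (fun R : ℝ => (∫ x in (-R)..R, g (x + (-ε : ℝ) * Complex.I)) -
      (∫ x in (-R)..R, g (x + ε * Complex.I))) atTop (nhds 0) := by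
    have h1 : Tendsto (fun R : ℝ => ∫ y in (-ε)..ε, g (R + y * Complex.I)) atTop (nhds 0) := by
      refine squeeze_zero_norm hvert ?_
      simpa using ((tendsto_exp_mul_exp_neg_exp hμ).const_mul M).mul_const (2 * ε)
    have h2 : Tendsto (fun R : ℝ => ∫ y in (-ε)..ε, g ((-R : ℝ) + y * Complex.I)) atTop
        (nhds 0) := by
      refine squeeze_zero_norm (a := fun R => M * Real.exp (-R) * (2 * ε))
        (fun R => (hvert (-R)).trans ?_) ?_
      · have : Real.exp (-μ * Real.exp (-R)) ≤ 1 := by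
          rw [Real.exp_le_one_iff]
          have := Real.exp_pos (-R)
          nlinarith
        gcongr
        exact mul_le_of_le_one_right (Real.exp_pos _).le this
      · simpa using (Real.tendsto_exp_neg_atTop_nhds_zero.const_mul M).mul_const (2 * ε)
    have h3 := (h2.const_mul Complex.I).sub (h1.const_mul Complex.I)
    rw [mul_zero, sub_zero] at h3
    refine h3.congr' ?_
    filter_upwards [eventually_gt_atTop 0] with R hR
    exact (hrect R hR).symm
  have hlim := (intervalIntegral_tendsto_integral hm.1 tendsto_neg_atTop_atBot tendsto_id).sub
    (intervalIntegral_tendsto_integral hp.1 tendsto_neg_atTop_atBot tendsto_id)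
  have := tendsto_nhds_unique hlim hR
  exact (sub_eq_zero.1 this).symm

lemma calG_self_zero {p : ℕ} (a b : Fin p → ℂ) (s τ : ℂ) :
    calG p 0 a b s τ = (∏ j, barnesG (b j - s) τ) / ∏ j, barnesG (a j - s) τ := by
  have h : ∀ j : Fin p, ¬ p ≤ (j : ℕ) := fun j => by simp
  simp [calG, h]

lemma mul_sqrt_le {K μ r : ℝ} (hμ : 0 < μ) (hr : 0 ≤ r) :
    K * √r ≤ K ^ 2 / (2 * μ) + μ / 2 * r := by
  have h : 0 ≤ (K - μ * √r) ^ 2 / (2 * μ) := by positivity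
  have e : (K - μ * √r) ^ 2 / (2 * μ) = K ^ 2 / (2 * μ) + μ / 2 * (√r) ^ 2 - K * √r := by
    field_simp
    ring
  rw [e, Real.sq_sqrt hr] at h
  linarith

/-- Vanishing of `K^{p,0}_{p,p}(a;b|z;τ)` for `0 < z < 1` in the logarithmic case. -/
theorem Kfun_logcase_vanishes_left {p : ℕ} (hp : 1 ≤ p) (τ : ℝ) (hτ : 0 < τ)
    (a b : Fin p → ℂ) (hab : ∑ j, a j = ∑ j, b j)
    (ε : ℝ) (hε : ε ∈ Set.Ioo 0 (Real.pi / 2))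
    (c : ℝ) (hc : ∀ j : Fin p, c < (a j).re)
    (z : ℝ) (hz0 : 0 < z) (hz1 : z < 1) :
    MeasureTheory.IntegrableOn (fun t : ℝ =>
        calG p 0 a b ((c : ℂ) + t * Complex.exp (((Real.pi - ε : ℝ) : ℂ) * Complex.I)) (τ : ℂ) *
          Complex.exp (-(((c : ℂ) + t * Complex.exp (((Real.pi - ε : ℝ) : ℂ) * Complex.I))
            * Real.log z)))
      (Set.Ioi 0) ∧
    MeasureTheory.IntegrableOn (fun t : ℝ =>
        calG p 0 a b ((c : ℂ) + t * Complex.exp (-(((Real.pi - ε : ℝ) : ℂ) * Complex.I)))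
            (τ : ℂ) *
          Complex.exp (-(((c : ℂ) + t * Complex.exp (-(((Real.pi - ε : ℝ) : ℂ) * Complex.I)))
            * Real.log z)))
      (Set.Ioi 0) ∧
    1 / (2 * Real.pi * Complex.I) *
        (Complex.exp (((Real.pi - ε : ℝ) : ℂ) * Complex.I) *
            (∫ t in Set.Ioi (0 : ℝ),
              calG p 0 a b ((c : ℂ) + t * Complex.exp (((Real.pi - ε : ℝ) : ℂ) * Complex.I))
                  (τ : ℂ) *
                Complex.exp (-(((c : ℂ) + t * Complex.exp (((Real.pi - ε : ℝ) : ℂ) * Complex.I))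
                  * Real.log z)))
          - Complex.exp (-(((Real.pi - ε : ℝ) : ℂ) * Complex.I)) *
            (∫ t in Set.Ioi (0 : ℝ),
              calG p 0 a b ((c : ℂ) + t * Complex.exp (-(((Real.pi - ε : ℝ) : ℂ) * Complex.I)))
                  (τ : ℂ) *
                Complex.exp (-(((c : ℂ)
                    + t * Complex.exp (-(((Real.pi - ε : ℝ) : ℂ) * Complex.I)))
                  * Real.log z)))) = 0 := by
  have hL : Real.log z < 0 := Real.log_neg hz0 hz1
  have hcos : 0 < Real.cos ε :=
    Real.cos_pos_of_mem_Ioo ⟨by linarith [hε.1, Real.pi_pos], hε.2⟩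
  set μ : ℝ := -Real.log z * Real.cos ε with hμdef
  have hμ : 0 < μ := mul_pos (by linarith) hcos
  set f : ℂ → ℂ := fun v => calG p 0 a b (c - v) τ * Complex.exp (-((c - v) * Real.log z)) with hf
  have hα : ∀ j, 0 < (a j - c).re := fun j => by simpa using hc j
  have hsum : ∑ j, (a j - (c : ℂ)) = ∑ j, (b j - (c : ℂ)) := by
    rw [Finset.sum_sub_distrib, Finset.sum_sub_distrib, hab]
  have hcal : ∀ v : ℂ, calG p 0 a b (c - v) τ =
      (∏ j, barnesG ((b j - c) + v) τ) / ∏ j, barnesG ((a j - c) + v) τ := by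
    intro v
    rw [calG_self_zero]
    simp only [sub_sub_eq_add_sub, sub_add_eq_add_sub]
  have hfd : DifferentiableOn ℂ f {v | 0 < v.re} := by
    have hd : ∀ γ : Fin p → ℂ, Differentiable ℂ fun v : ℂ => ∏ j, barnesG (γ j - c + v) τ :=
      fun γ => Differentiable.fun_finsetProd fun j _ =>
        (differentiable_barnesG hτ).comp (differentiable_id.const_add _)
    simp only [hf, hcal]
    refine DifferentiableOn.mul (DifferentiableOn.div (hd b).differentiableOn
      (hd a).differentiableOn fun v hv => ?_) (by fun_prop)
    refine Finset.prod_ne_zero_iff.2 fun j _ => barnesG_ne_zero hτ ?_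
    rw [Complex.add_re]
    exact add_pos (hα j) hv
  obtain ⟨M, K, hM, -, hMK⟩ :=
    exists_norm_barnesG_ratio_le hτ (fun j => a j - c) (fun j => b j - c) hsum hα
  have hfb : ∀ r θ : ℝ, 0 < r → |θ| ≤ ε → ‖f (r * Complex.exp (θ * Complex.I))‖ ≤
      M * Real.exp (K ^ 2 / (2 * μ)) * Real.exp (-(c * Real.log z)) * Real.exp (-(μ / 2) * r) := by
    intro r θ hr hθ
    have hcosle : Real.cos ε ≤ Real.cos θ := by
      rw [← Real.cos_abs θ]
      exact Real.cos_le_cos_of_nonneg_of_le_pi (abs_nonneg _) (by linarith [hε.2, Real.pi_pos]) hθ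
    have hre : ((r : ℂ) * Complex.exp (θ * Complex.I)).re = r * Real.cos θ := by
      rw [Complex.re_ofReal_mul, Complex.exp_ofReal_mul_I_re]
    have hn : ‖(r : ℂ) * Complex.exp (θ * Complex.I)‖ = r := by
      rw [norm_mul, Complex.norm_exp_ofReal_mul_I, mul_one, Complex.norm_real,
        Real.norm_of_nonneg hr.le]
    set v : ℂ := (r : ℂ) * Complex.exp (θ * Complex.I)
    have h1 := hMK v (by rw [hre]; exact mul_nonneg hr.le (hcos.le.trans hcosle))
    rw [hn, ← hcal] at h1
    have h2 : ‖Complex.exp (-((c - v) * Real.log z))‖ ≤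
        Real.exp (-(c * Real.log z)) * Real.exp (-μ * r) := by
      rw [Complex.norm_exp, ← Real.exp_add]
      apply Real.exp_le_exp.2
      rw [Complex.neg_re, Complex.re_mul_ofReal, Complex.sub_re, Complex.ofReal_re, hre, hμdef]
      nlinarith [mul_nonneg (mul_nonneg hr.le (neg_nonneg.2 hL.le)) (sub_nonneg.2 hcosle)]
    calc ‖f v‖ ≤ M * Real.exp (K * √r) * (Real.exp (-(c * Real.log z)) * Real.exp (-μ * r)) := by
          rw [hf, norm_mul]
          gcongr
      _ ≤ M * Real.exp (K ^ 2 / (2 * μ) + μ / 2 * r) *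
          (Real.exp (-(c * Real.log z)) * Real.exp (-μ * r)) := by
          gcongr
          exact mul_sqrt_le hμ hr.le
      _ = _ := by
          rw [Real.exp_add, show -(μ / 2) * r = μ / 2 * r + -μ * r by ring, Real.exp_add]
          ring
  obtain ⟨hp', hm', heq⟩ := integral_ray_rotate hε.1 hε.2 (by positivity) (half_pos hμ) hfd hfb
  have e1 : Complex.exp (((Real.pi - ε : ℝ) : ℂ) * Complex.I) =
      -Complex.exp (-(ε * Complex.I)) := by
    rw [show ((Real.pi - ε : ℝ) : ℂ) * Complex.I = -(ε * Complex.I) + Real.pi * Complex.I by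
      push_cast; ring, Complex.exp_add, Complex.exp_pi_mul_I]
    ring
  have e2 : Complex.exp (-(((Real.pi - ε : ℝ) : ℂ) * Complex.I)) =
      -Complex.exp (ε * Complex.I) := by
    rw [Complex.exp_neg, e1, Complex.exp_neg, inv_neg, inv_inv]
  simp only [e1, e2, mul_neg, ← sub_eq_add_neg]
  refine ⟨hm', hp', ?_⟩
  simp only [hf] at heq
  rw [neg_mul, neg_mul, ← heq]
  ring
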